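/- arXiv:1212.2126 — 2 statements merged into one kernel-verified Lean document; each statement's English description precedes it below -/
import Mathlib

section
/- Fix integers N ≥ 1, K ≥ 2, D ≥ 1, data points x_1, …, x_N ∈ ℝ^D, an assignment z ∈ {0,1}^{N×K} with exactly one entry equal to 1 in each row (empty clusters are allowed), cluster sizes S_k = Σ_{n=1}^N z_{nk}, cluster means μ_1, …, μ_K ∈ ℝ^D, and constants ρ² > 0 and λ² > 0. Let K⁺ = #{k : S_k ≥ 1} be the number of nonempty clusters. For σ² > 0 set θ(σ²) = exp(−λ²/(2σ²)) and define P(σ²) = [Π_{k=1}^K Π_{n: z_{nk}=1} (2πσ²)^{−D/2} exp(−‖x_n − μ_k‖²/(2σ²))] · (Γ(Kθ(σ²))/Γ(N + Kθ(σ²))) · Π_{k=1}^K (Γ(S_k + θ(σ²))/Γ(θ(σ²))) · Π_{k=1}^K (2πρ²)^{−D/2} exp(−‖μ_k‖²/(2ρ²)). Then −2σ² log P(σ²) converges to Σ_{k=1}^K Σ_{n: z_{nk}=1} ‖x_n − μ_k‖² + (K⁺ − 1)λ² as σ² → 0⁺. -/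
open Matrix Filter Finset Real

/-- `f` is eventually positive near `0⁺` and `-2s log f(s)` tends to `c` as `s → 0⁺`, that is,
`f(s)` behaves like `exp(-c/(2s))` on the exponential scale. -/
def HasExpRate (f : ℝ → ℝ) (c : ℝ) : Prop :=
  (∀ᶠ s in nhdsWithin 0 (Set.Ioi 0), 0 < f s) ∧
    Tendsto (fun s => -2 * s * Real.log (f s)) (nhdsWithin 0 (Set.Ioi 0)) (nhds c)

namespace HasExpRate

theorem mul {f g : ℝ → ℝ} {a b : ℝ} (hf : HasExpRate f a) (hg : HasExpRate g b) :
    HasExpRate (fun s => f s * g s) (a + b) := by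
  refine ⟨by filter_upwards [hf.1, hg.1] with s h₁ h₂ using mul_pos h₁ h₂,
    (hf.2.add hg.2).congr' ?_⟩
  filter_upwards [hf.1, hg.1] with s h₁ h₂
  rw [Real.log_mul h₁.ne' h₂.ne']
  ring

theorem div {f g : ℝ → ℝ} {a b : ℝ} (hf : HasExpRate f a) (hg : HasExpRate g b) :
    HasExpRate (fun s => f s / g s) (a - b) := by
  refine ⟨by filter_upwards [hf.1, hg.1] with s h₁ h₂ using div_pos h₁ h₂,
    (hf.2.sub hg.2).congr' ?_⟩
  filter_upwards [hf.1, hg.1] with s h₁ h₂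
  rw [Real.log_div h₁.ne' h₂.ne']
  ring

theorem congr {f g : ℝ → ℝ} {a : ℝ} (hf : HasExpRate f a) (h : ∀ s, 0 < s → g s = f s) :
    HasExpRate g a := by
  have hfg : f =ᶠ[nhdsWithin 0 (Set.Ioi 0)] g := by
    filter_upwards [self_mem_nhdsWithin] with s hs using (h s hs).symm
  refine ⟨by filter_upwards [hfg, hf.1] with s h₁ h₂ using h₁ ▸ h₂, hf.2.congr' ?_⟩
  filter_upwards [hfg] with s h₁
  rw [h₁]

theorem of_tendsto {f : ℝ → ℝ} {L : ℝ} (hL : 0 < L)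
    (hf : Tendsto f (nhdsWithin 0 (Set.Ioi 0)) (nhds L)) : HasExpRate f 0 := by
  refine ⟨hf.eventually (lt_mem_nhds hL), ?_⟩
  have hid : Tendsto (fun s : ℝ => -2 * s) (nhdsWithin 0 (Set.Ioi 0)) (nhds (-2 * 0)) :=
    (tendsto_id.const_mul (-2)).mono_left nhdsWithin_le_nhds
  simpa using hid.mul (hf.log hL.ne')

theorem const {c : ℝ} (hc : 0 < c) : HasExpRate (fun _ => c) 0 :=
  of_tendsto hc tendsto_const_nhds

theorem prod {ι : Type*} (t : Finset ι) {f : ι → ℝ → ℝ} {a : ι → ℝ}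
    (h : ∀ i ∈ t, HasExpRate (f i) (a i)) :
    HasExpRate (fun s => ∏ i ∈ t, f i s) (∑ i ∈ t, a i) := by
  classical
  induction t using Finset.induction_on with
  | empty => simpa using const one_pos
  | insert i t hi ih =>
    simp only [Finset.prod_insert hi, Finset.sum_insert hi]
    exact (h i (mem_insert_self i t)).mul (ih fun j hj => h j (mem_insert_of_mem hj))

theorem exp_neg_div (a : ℝ) : HasExpRate (fun s => Real.exp (-a / (2 * s))) a := by
  refine ⟨.of_forall fun s => Real.exp_pos _, tendsto_const_nhds.congr' ?_⟩
  filter_upwards [self_mem_nhdsWithin] with s hs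
  have hs : s ≠ 0 := (Set.mem_Ioi.mp hs).ne'
  rw [Real.log_exp]
  field_simp

theorem rpow {c : ℝ} (hc : 0 < c) (p : ℝ) : HasExpRate (fun s => (c * s) ^ p) 0 := by
  refine ⟨?_, ?_⟩
  · filter_upwards [self_mem_nhdsWithin] with s hs
    exact Real.rpow_pos_of_pos (mul_pos hc hs) p
  · have hlog : Tendsto (fun s : ℝ => Real.log s * s) (nhdsWithin 0 (Set.Ioi 0)) (nhds 0) := by
      simpa using tendsto_log_mul_rpow_nhdsGT_zero one_pos
    have h := ((const hc).2.const_mul p).add (hlog.const_mul (-2 * p))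
    simp only [mul_zero, add_zero] at h
    refine h.congr' ?_
    filter_upwards [self_mem_nhdsWithin] with s hs
    rw [Real.log_rpow (mul_pos hc hs), Real.log_mul hc.ne' (Set.mem_Ioi.mp hs).ne']
    ring

theorem Gamma_add {f : ℝ → ℝ} (hf : Tendsto f (nhdsWithin 0 (Set.Ioi 0)) (nhds 0)) {c : ℝ}
    (hc : 0 < c) : HasExpRate (fun s => Real.Gamma (c + f s)) 0 := by
  refine of_tendsto (Real.Gamma_pos_of_pos hc) ?_
  have hcont : ContinuousAt Real.Gamma c :=
    (Real.differentiableAt_Gamma fun m =>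
      ((neg_nonpos.mpr m.cast_nonneg).trans_lt hc).ne').continuousAt
  exact hcont.tendsto.comp (by simpa using hf.const_add c)

/-- Near its pole at `0` the Gamma function is `Γ(y) = Γ(1 + y) / y`. -/
theorem Gamma {f : ℝ → ℝ} {a : ℝ} (hf : HasExpRate f a) (hpos : ∀ s, 0 < f s)
    (hzero : Tendsto f (nhdsWithin 0 (Set.Ioi 0)) (nhds 0)) :
    HasExpRate (fun s => Real.Gamma (f s)) (-a) := by
  rw [← zero_sub]
  refine ((Gamma_add hzero one_pos).div hf).congr fun s _ => ?_
  rw [add_comm, Real.Gamma_add_one (hpos s).ne', mul_div_cancel_left₀ _ (hpos s).ne']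

end HasExpRate

theorem tendsto_exp_neg_div_nhdsGT_zero {a : ℝ} (ha : 0 < a) :
    Tendsto (fun s => Real.exp (-a / (2 * s))) (nhdsWithin 0 (Set.Ioi 0)) (nhds 0) := by
  refine Real.tendsto_exp_atBot.comp ?_
  refine (tendsto_inv_nhdsGT_zero.const_mul_atTop_of_neg (r := -a / 2) (by linarith)).congr
    fun s => ?_
  rw [div_mul_eq_div_div, div_eq_mul_inv (-a / 2)]

/-- Small-variance asymptotics for the Dirichlet-multinomial Gaussian mixture with
scaled concentration `θ(σ²) = exp(−λ²/(2σ²))`: `-2σ² log P(σ²)` converges to the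
K-means objective plus a penalty of `λ²` per activated cluster beyond the first. -/
theorem penalized_k_means_objective_limit
    (N K D : ℕ) (hN : 1 ≤ N) (hK : 2 ≤ K) (hD : 1 ≤ D)
    (x : Fin N → EuclideanSpace ℝ (Fin D))
    (z : Fin N → Fin K → ℕ)
    (hzbin : ∀ n k, z n k = 0 ∨ z n k = 1)
    (hrow : ∀ n, ∑ k, z n k = 1)
    (S : Fin K → ℕ) (hS : ∀ k, S k = ∑ n, z n k)
    (Kplus : ℕ) (hKplus : Kplus = (univ.filter (fun k => 1 ≤ S k)).card)
    (μ : Fin K → EuclideanSpace ℝ (Fin D))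
    (ρ2 lam2 : ℝ) (hρ2 : 0 < ρ2) (hlam2 : 0 < lam2)
    (θ : ℝ → ℝ) (hθ : ∀ s, θ s = Real.exp (-lam2 / (2 * s)))
    (P : ℝ → ℝ)
    (hP : ∀ s, 0 < s → P s =
      (∏ k, ∏ n ∈ univ.filter (fun n => z n k = 1),
          ((2 * Real.pi * s) ^ (-(D : ℝ) / 2) * Real.exp (-‖x n - μ k‖ ^ 2 / (2 * s))))
      * (Real.Gamma (K * θ s) / Real.Gamma (N + K * θ s))
      * (∏ k, (Real.Gamma (S k + θ s) / Real.Gamma (θ s)))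
      * (∏ k, ((2 * Real.pi * ρ2) ^ (-(D : ℝ) / 2)
          * Real.exp (-‖μ k‖ ^ 2 / (2 * ρ2))))) :
    Tendsto (fun s => -2 * s * Real.log (P s)) (nhdsWithin 0 (Set.Ioi 0))
      (nhds ((∑ k, ∑ n ∈ univ.filter (fun n => z n k = 1), ‖x n - μ k‖ ^ 2)
        + ((Kplus : ℝ) - 1) * lam2)) := by
  obtain rfl : θ = fun s => Real.exp (-lam2 / (2 * s)) := funext hθ
  have hθ_zero := tendsto_exp_neg_div_nhdsGT_zero hlam2
  have hθ_rate := HasExpRate.exp_neg_div lam2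
  have hK_pos : (0 : ℝ) < K := by exact_mod_cast (by omega : 0 < K)
  have hN_pos : (0 : ℝ) < N := by exact_mod_cast hN
  have hKθ_zero : Tendsto (fun s => (K : ℝ) * Real.exp (-lam2 / (2 * s)))
      (nhdsWithin 0 (Set.Ioi 0)) (nhds 0) := by
    simpa using hθ_zero.const_mul (K : ℝ)
  have hlik := HasExpRate.prod univ fun k (_ : k ∈ univ) =>
    HasExpRate.prod (univ.filter fun n => z n k = 1) fun n _ =>
      (HasExpRate.rpow Real.two_pi_pos (-(D : ℝ) / 2)).mul
        (HasExpRate.exp_neg_div (‖x n - μ k‖ ^ 2))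
  have hnorm := (((HasExpRate.const hK_pos).mul hθ_rate).Gamma
    (fun s => mul_pos hK_pos (Real.exp_pos _)) hKθ_zero).div
      (HasExpRate.Gamma_add hKθ_zero hN_pos)
  have hΓθ := hθ_rate.Gamma (fun s => Real.exp_pos _) hθ_zero
  have hcluster : ∀ k, HasExpRate
      (fun s => Real.Gamma (S k + Real.exp (-lam2 / (2 * s))) /
        Real.Gamma (Real.exp (-lam2 / (2 * s))))
      (if 1 ≤ S k then lam2 else 0) := by
    intro k
    split_ifs with hk
    · have hSk : (0 : ℝ) < S k := by exact_mod_cast hk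
      simpa using (HasExpRate.Gamma_add hθ_zero hSk).div hΓθ
    · have hSk : S k = 0 := by omega
      simpa [hSk] using hΓθ.div hΓθ
  have hprior : HasExpRate (fun _ => ∏ k, ((2 * Real.pi * ρ2) ^ (-(D : ℝ) / 2)
      * Real.exp (-‖μ k‖ ^ 2 / (2 * ρ2)))) 0 :=
    HasExpRate.const (prod_pos fun k _ => by positivity)
  have hrate := (((hlik.mul hnorm).mul
    (HasExpRate.prod univ fun k _ => hcluster k)).mul hprior).congr hP
  convert hrate.2 using 2
  rw [← sum_filter, sum_const, nsmul_eq_mul, ← hKplus]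
  simp only [zero_add]
  ring
end

section
/- Fix integers N ≥ 1, K ≥ 1, D ≥ 1, a data matrix X ∈ ℝ^{N×D}, a binary feature matrix Z ∈ {0,1}^{N×K} (empty features allowed) with feature sizes S_k = Σ_{n=1}^N Z_{nk}, a feature-means matrix A ∈ ℝ^{K×D}, and constants γ > 0 and ρ² > 0. For σ² > 0 define P(σ²) = (2πσ²)^{−ND/2} exp(−tr((X − ZA)ᵀ(X − ZA))/(2σ²)) · Π_{k=1}^K [Γ(S_k + γ) Γ(N − S_k + 1) Γ(γ + 1) / (Γ(N + γ + 1) Γ(γ))] · (2πρ²)^{−KD/2} exp(−tr(AᵀA)/(2ρ²)). Then −2σ² log P(σ²) converges to tr((X − ZA)ᵀ(X − ZA)) as σ² → 0⁺. -/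
open Matrix Filter Finset Real

/-- The product of `-2 * s` and the logarithm of a Gaussian-type density
`(2 * π * s) ^ c * exp (-T / (2 * s))` times a nonzero constant
tends to `T` as `s → 0⁺`. -/
theorem tendsto_neg_two_mul_log_gaussian (c T C : ℝ) (hC : C ≠ 0) :
    Tendsto (fun s : ℝ => -2 * s * Real.log
        ((2 * Real.pi * s) ^ c * Real.exp (-T / (2 * s)) * C))
      (nhdsWithin 0 (Set.Ioi 0)) (nhds T) := by
  have hcont : Continuous fun s : ℝ =>
      T - 2 * c * (s * Real.log s) - 2 * (c * Real.log (2 * Real.pi) + Real.log C) * s :=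
    (continuous_const.sub (continuous_const.mul Real.continuous_mul_log)).sub
      (continuous_const.mul continuous_id)
  have hlim := (hcont.tendsto 0).mono_left (nhdsWithin_le_nhds (s := Set.Ioi 0))
  simp only [zero_mul, mul_zero, sub_zero] at hlim
  refine hlim.congr' ?_
  filter_upwards [self_mem_nhdsWithin] with s hs
  have hs : 0 < s := hs
  have hpi : 0 < 2 * Real.pi := Real.two_pi_pos
  have hpow : 0 < (2 * Real.pi * s) ^ c := Real.rpow_pos_of_pos (mul_pos hpi hs) c
  rw [Real.log_mul (mul_pos hpow (Real.exp_pos _)).ne' hC,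
    Real.log_mul hpow.ne' (Real.exp_pos _).ne', Real.log_exp,
    Real.log_rpow (mul_pos hpi hs), Real.log_mul hpi.ne' hs.ne']
  field_simp
  ring

/-- A binary column of length `N` has sum at most `N`. -/
theorem sum_le_of_binary {N : ℕ} (z : Fin N → ℝ) (hz : ∀ n, z n = 0 ∨ z n = 1) :
    ∑ n, z n ≤ N := by
  calc ∑ n, z n ≤ ∑ _n : Fin N, (1 : ℝ) :=
        Finset.sum_le_sum fun n _ => by rcases hz n with h | h <;> simp [h]
    _ = N := by simp

/-- Small-variance asymptotics for the Beta-Bernoulli linear-Gaussian feature model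
with fixed `γ`: `-2σ² log P(σ²)` converges to the K-features objective as `σ² → 0⁺`. -/
theorem k_features_objective_limit
    (N K D : ℕ) (hN : 1 ≤ N) (hK : 1 ≤ K) (hD : 1 ≤ D)
    (X : Matrix (Fin N) (Fin D) ℝ)
    (Z : Matrix (Fin N) (Fin K) ℝ)
    (hZbin : ∀ n k, Z n k = 0 ∨ Z n k = 1)
    (S : Fin K → ℕ) (hS : ∀ k, (S k : ℝ) = ∑ n, Z n k)
    (A : Matrix (Fin K) (Fin D) ℝ)
    (γ ρ2 : ℝ) (hγ : 0 < γ) (hρ2 : 0 < ρ2)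
    (P : ℝ → ℝ)
    (hP : ∀ s, 0 < s → P s =
      ((2 * Real.pi * s) ^ (-((N : ℝ) * D) / 2)
        * Real.exp (- Matrix.trace ((X - Z * A)ᵀ * (X - Z * A)) / (2 * s)))
      * (∏ k, (Real.Gamma (S k + γ) * Real.Gamma ((N : ℝ) - S k + 1) * Real.Gamma (γ + 1)
          / (Real.Gamma ((N : ℝ) + γ + 1) * Real.Gamma γ)))
      * ((2 * Real.pi * ρ2) ^ (-((K : ℝ) * D) / 2)
          * Real.exp (- Matrix.trace (Aᵀ * A) / (2 * ρ2)))) :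
    Tendsto (fun s => -2 * s * Real.log (P s)) (nhdsWithin 0 (Set.Ioi 0))
      (nhds (Matrix.trace ((X - Z * A)ᵀ * (X - Z * A)))) := by
  have hprod : 0 < ∏ k, (Real.Gamma (S k + γ) * Real.Gamma ((N : ℝ) - S k + 1)
      * Real.Gamma (γ + 1) / (Real.Gamma ((N : ℝ) + γ + 1) * Real.Gamma γ)) := by
    refine Finset.prod_pos fun k _ => ?_
    have hSN : (S k : ℝ) ≤ N := hS k ▸ sum_le_of_binary (fun n => Z n k) fun n => hZbin n k
    have h₁ := Real.Gamma_pos_of_pos (show 0 < (S k : ℝ) + γ by positivity)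
    have h₂ := Real.Gamma_pos_of_pos (show 0 < (N : ℝ) - S k + 1 by linarith)
    have h₃ := Real.Gamma_pos_of_pos (show 0 < γ + 1 by positivity)
    have h₄ := Real.Gamma_pos_of_pos (show 0 < (N : ℝ) + γ + 1 by positivity)
    have h₅ := Real.Gamma_pos_of_pos hγ
    positivity
  have hprior : 0 < (2 * Real.pi * ρ2) ^ (-((K : ℝ) * D) / 2)
      * Real.exp (- Matrix.trace (Aᵀ * A) / (2 * ρ2)) := by positivity
  refine (tendsto_neg_two_mul_log_gaussian (-((N : ℝ) * D) / 2) _ _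
    (mul_pos hprod hprior).ne').congr' ?_
  filter_upwards [self_mem_nhdsWithin] with s hs
  rw [hP s hs, mul_assoc (_ * _) (∏ k, _)]
end
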